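/- Margin transformation (Theorem 5.1): Let K ≥ 2 be an integer and let (x_1,y_1),…,(x_T,y_T) be labeled examples in the closed unit ball of ℝ^d with labels in {1,…,K} that are weakly linearly separable with margin γ > 0. Define γ₁ = (1/(2√K))·[376·⌈log₂(2K−2)⌉·⌈√(2/γ)⌉]^{−(1/2)·⌈log₂(2K−2)⌉·⌈√(2/γ)⌉} and γ₂ = (2^{s+1}·r·(K−1)·(4s+2))^{−(s+1/2)·r·(K−1)} / (4√K·(4K−5)·2^{K−1}), where r = 2⌈(1/4)log₂(4K−3)⌉ + 1 and s = ⌈log₂(2/γ)⌉. Then the transformed labeled examples (φ(x_1),y_1),…,(φ(x_T),y_T) in ℓ² are strongly linearly separable with margin γ' = max{γ₁, γ₂}, and moreover ‖φ(x_t)‖²_{ℓ²} ≤ 2 for all t ∈ {1,…,T}. -/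

import Mathlib

open scoped RealInnerProductSpace
open Finset

/-- Labeled examples are weakly linearly separable with margin `γ`. -/
def WeaklySeparable {V : Type*} [NormedAddCommGroup V] [InnerProductSpace ℝ V]
    {T K : ℕ} (x : Fin T → V) (y : Fin T → Fin K) (γ : ℝ) : Prop :=
  ∃ w : Fin K → V, (∑ i, ‖w i‖ ^ 2 ≤ 1) ∧
    ∀ t : Fin T, ∀ i : Fin K, i ≠ y t → ⟪x t, w (y t)⟫ ≥ ⟪x t, w i⟫ + γ

/-- Labeled examples are strongly linearly separable with margin `γ`. -/
def StronglySeparable {V : Type*} [NormedAddCommGroup V] [InnerProductSpace ℝ V]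
    {T K : ℕ} (x : Fin T → V) (y : Fin T → Fin K) (γ : ℝ) : Prop :=
  ∃ w : Fin K → V, (∑ i, ‖w i‖ ^ 2 ≤ 1) ∧
    (∀ t : Fin T, ⟪x t, w (y t)⟫ ≥ γ / 2) ∧
    ∀ t : Fin T, ∀ i : Fin K, i ≠ y t → ⟪x t, w i⟫ ≤ -(γ / 2)

/-- The feature map associated with the rational kernel: the coordinate of `φ(x)` at the
multi-index `α` is `x^α · sqrt(2^{-|α|} · |α|!/(α₁!⋯α_d!))`. -/
noncomputable def phiMap (d : ℕ) (x : EuclideanSpace ℝ (Fin d)) (α : Fin d →₀ ℕ) : ℝ :=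
  (∏ i, x i ^ α i) *
    Real.sqrt (((2 : ℝ) ^ (∑ i, α i))⁻¹ * (Nat.multinomial Finset.univ α : ℝ))

/-- The Hilbert space used for the feature map. -/
abbrev HH (d : ℕ) := lp (fun _ : Fin d →₀ ℕ => ℝ) 2

lemma memlp_of_sq {d : ℕ} {f : (Fin d →₀ ℕ) → ℝ} (h : Summable fun a => f a ^ 2) :
    Memℓp (E := fun _ : Fin d →₀ ℕ => ℝ) f 2 := by
  apply memℓp_gen
  simpa using h

lemma summable_sq {d : ℕ} (b : HH d) : Summable fun a => b a ^ 2 := by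
  have := (lp.memℓp b).summable (by norm_num)
  simpa using this

lemma norm_sq_eq {d : ℕ} (b : HH d) : ‖b‖ ^ 2 = ∑' a, b a ^ 2 := by
  have := lp.norm_rpow_eq_tsum (p := 2) (by norm_num) b
  simpa using this

lemma phi_sq {d : ℕ} (x : EuclideanSpace ℝ (Fin d)) (a : Fin d →₀ ℕ) :
    phiMap d x a ^ 2 = ((2 : ℝ) ^ (∑ i, a i))⁻¹ *
      ((Nat.multinomial Finset.univ a : ℝ) * ∏ i, (x i ^ 2) ^ a i) := by
  unfold phiMap
  rw [mul_pow, Real.sq_sqrt (by positivity), ← Finset.prod_pow]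
  have : ∀ i, (x i ^ a i) ^ 2 = (x i ^ 2) ^ a i := fun i => by rw [← pow_mul, ← pow_mul, mul_comm]
  simp only [this]
  ring

lemma phi_sum_le {d : ℕ} (x : EuclideanSpace ℝ (Fin d)) (hx : ‖x‖ ≤ 1)
    (u : Finset (Fin d →₀ ℕ)) : ∑ a ∈ u, phiMap d x a ^ 2 ≤ 2 := by
  classical
  set N := (u.sup fun a => ∑ i, a i) + 1
  have hx2 : ∑ i, x i ^ 2 ≤ 1 := by
    have := EuclideanSpace.norm_sq_eq x
    simp only [Real.norm_eq_abs, sq_abs] at this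
    rw [← this]
    exact pow_le_one₀ (norm_nonneg _) hx
  have hmaps : ∀ a ∈ u, (∑ i, a i) ∈ Finset.range N := by
    intro a ha
    rw [Finset.mem_range]
    exact Nat.lt_succ_of_le (Finset.le_sup (f := fun a : Fin d →₀ ℕ => ∑ i, a i) ha)
  rw [← Finset.sum_fiberwise_of_maps_to hmaps]
  have hb : ∀ n ∈ Finset.range N, ∑ a ∈ u with (∑ i, a i) = n, phiMap d x a ^ 2 ≤ (1 / 2 : ℝ) ^ n := by
    intro n _
    have h1 : ∑ a ∈ u with (∑ i, a i) = n, phiMap d x a ^ 2 =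
        ∑ a ∈ u with (∑ i, a i) = n, ((2 : ℝ) ^ n)⁻¹ *
      ((Nat.multinomial Finset.univ a : ℝ) * ∏ i, (x i ^ 2) ^ a i) := by
      apply Finset.sum_congr rfl
      intro a ha
      rw [phi_sq, (Finset.mem_filter.1 ha).2]
    rw [h1, ← Finset.mul_sum]
    have h2 : ∑ a ∈ u with (∑ i, a i) = n,
        ((Nat.multinomial Finset.univ a : ℝ) * ∏ i, (x i ^ 2) ^ a i) ≤
        ∑ k ∈ (Finset.univ : Finset (Fin d)).piAntidiag n,
          ((Nat.multinomial Finset.univ k : ℝ) * ∏ i, (x i ^ 2) ^ k i) := by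
      rw [← Finset.sum_image (s := u.filter (fun a : Fin d →₀ ℕ => (∑ i, a i) = n))
        (g := fun a : Fin d →₀ ℕ => (a : Fin d → ℕ))
        (f := fun k : Fin d → ℕ => ((Nat.multinomial Finset.univ k : ℝ) * ∏ i, (x i ^ 2) ^ k i))
        (fun a _ b _ h => DFunLike.coe_injective h)]
      apply Finset.sum_le_sum_of_subset_of_nonneg
      · intro k hk
        obtain ⟨a, ha, rfl⟩ := Finset.mem_image.1 hk
        rw [Finset.mem_piAntidiag]
        exact ⟨(Finset.mem_filter.1 ha).2, fun i _ => Finset.mem_univ i⟩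
      · intros; positivity
    rw [← Finset.sum_pow_eq_sum_piAntidiag] at h2
    have h3 : (∑ i, x i ^ 2) ^ n ≤ 1 := pow_le_one₀ (by positivity) hx2
    rw [one_div, inv_pow]
    have : 0 < ((2 : ℝ) ^ n)⁻¹ := by positivity
    nlinarith
  exact (Finset.sum_le_sum hb).trans (sum_geometric_two_le N)

lemma phi_mem {d : ℕ} (x : EuclideanSpace ℝ (Fin d)) (hx : ‖x‖ ≤ 1) :
    Memℓp (E := fun _ : Fin d →₀ ℕ => ℝ) (phiMap d x) 2 :=
  memlp_of_sq (summable_of_sum_le (fun _ => sq_nonneg _) (phi_sum_le x hx))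

/-- Adding one to the coordinate `i` of a multi-index. -/
noncomputable def up {d : ℕ} (i : Fin d) (a : Fin d →₀ ℕ) : Fin d →₀ ℕ := a + Finsupp.single i 1

lemma up_inj {d : ℕ} (i : Fin d) : Function.Injective (up i) := fun _ _ h => add_right_cancel h

/-- Weight of the shift. -/
noncomputable def wt {d : ℕ} (i : Fin d) (a : Fin d →₀ ℕ) : ℝ :=
  2 * (a i : ℝ) / ((∑ j, a j : ℕ) : ℝ)

lemma wt_nonneg {d : ℕ} (i : Fin d) (a : Fin d →₀ ℕ) : 0 ≤ wt i a := by
  unfold wt; positivity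

lemma wt_sum {d : ℕ} (a : Fin d →₀ ℕ) : ∑ i, wt i a ≤ 2 := by
  unfold wt
  rw [← Finset.sum_div, ← Finset.mul_sum]
  push_cast
  rcases eq_or_ne (∑ i, (a i : ℝ)) 0 with h | h
  · simp [h]
  · rw [mul_div_assoc, div_self h]; norm_num

lemma wt_le {d : ℕ} (i : Fin d) (a : Fin d →₀ ℕ) : wt i a ≤ 2 :=
  (Finset.single_le_sum (fun j _ => wt_nonneg j a) (Finset.mem_univ i)).trans (wt_sum a)

/-- The shift function. -/
noncomputable def shf {d : ℕ} (u : EuclideanSpace ℝ (Fin d)) (b : (Fin d →₀ ℕ) → ℝ)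
    (a : Fin d →₀ ℕ) : ℝ := ∑ i, u i * (Real.sqrt (wt i (up i a)) * b (up i a))

lemma shf_summable {d : ℕ} (u : EuclideanSpace ℝ (Fin d)) (b : (Fin d →₀ ℕ) → ℝ)
    (hb : Summable fun a => b a ^ 2) :
    Summable (fun a => shf u b a ^ 2) ∧
    ∑' a, shf u b a ^ 2 ≤ 2 * ‖u‖ ^ 2 * ∑' a, b a ^ 2 := by
  have hu : ‖u‖ ^ 2 = ∑ i, u i ^ 2 := by
    have := EuclideanSpace.norm_sq_eq u
    simpa only [Real.norm_eq_abs, sq_abs] using this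
  have hpt : ∀ a, shf u b a ^ 2 ≤ ‖u‖ ^ 2 * ∑ i, wt i (up i a) * b (up i a) ^ 2 := by
    intro a
    rw [hu]
    refine (Finset.sum_mul_sq_le_sq_mul_sq _ _ _).trans_eq ?_
    congr 1
    apply Finset.sum_congr rfl
    intro i _
    rw [mul_pow, Real.sq_sqrt (wt_nonneg _ _)]
  have hS : ∀ i, Summable fun a => wt i a * b a ^ 2 := fun i =>
    Summable.of_nonneg_of_le (fun a => mul_nonneg (wt_nonneg i a) (sq_nonneg _))
      (fun a => mul_le_mul_of_nonneg_right (wt_le i a) (sq_nonneg _)) (hb.mul_left 2)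
  have hS' : ∀ i, Summable fun a => wt i (up i a) * b (up i a) ^ 2 := fun i =>
    (hS i).comp_injective (up_inj i)
  have hS'' : Summable fun a => ‖u‖ ^ 2 * ∑ i, wt i (up i a) * b (up i a) ^ 2 :=
    (summable_sum fun i _ => hS' i).mul_left _
  have h1 : Summable (fun a => shf u b a ^ 2) :=
    Summable.of_nonneg_of_le (fun a => sq_nonneg _) hpt hS''
  refine ⟨h1, ?_⟩
  refine (h1.tsum_le_tsum hpt hS'').trans ?_
  rw [tsum_mul_left, Summable.tsum_finsetSum (fun i _ => hS' i)]
  have h2 : ∑ i, ∑' a, wt i (up i a) * b (up i a) ^ 2 ≤ ∑ i, ∑' a, wt i a * b a ^ 2 :=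
    Finset.sum_le_sum fun i _ => tsum_comp_le_tsum_of_inj (hS i)
      (fun a => mul_nonneg (wt_nonneg i a) (sq_nonneg _)) (up_inj i)
  have h3 : ∑ i, ∑' a, wt i a * b a ^ 2 ≤ 2 * ∑' a, b a ^ 2 := by
    rw [← Summable.tsum_finsetSum (fun i _ => hS i), ← tsum_mul_left]
    refine (summable_sum fun i _ => hS i).tsum_le_tsum (fun a => ?_) (hb.mul_left 2)
    rw [← Finset.sum_mul]
    exact mul_le_mul_of_nonneg_right (wt_sum a) (sq_nonneg _)
  have := mul_le_mul_of_nonneg_left (h2.trans h3) (sq_nonneg ‖u‖)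
  linarith

/-- The shift operator as a linear map. -/
noncomputable def shL {d : ℕ} (u : EuclideanSpace ℝ (Fin d)) : HH d →ₗ[ℝ] HH d where
  toFun b := ⟨shf u b, memlp_of_sq (shf_summable u b (summable_sq b)).1⟩
  map_add' b c := by
    ext a
    change shf u (b + c : HH d) a = shf u b a + shf u c a
    simp [shf, mul_add, Finset.sum_add_distrib]
  map_smul' r b := by
    ext a
    simp only [shf, lp.coeFn_smul, Pi.smul_apply, smul_eq_mul, RingHom.id_apply, Finset.mul_sum]
    apply Finset.sum_congr rfl
    intros; ring

lemma shL_norm {d : ℕ} (u : EuclideanSpace ℝ (Fin d)) (b : HH d) :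
    ‖shL u b‖ ≤ (Real.sqrt 2 * ‖u‖) * ‖b‖ := by
  apply le_of_sq_le_sq _ (by positivity)
  rw [norm_sq_eq, mul_pow, mul_pow, Real.sq_sqrt (by norm_num), norm_sq_eq b]
  exact (shf_summable u b (summable_sq b)).2

lemma phi_up {d : ℕ} (x : EuclideanSpace ℝ (Fin d)) (i : Fin d) (a : Fin d →₀ ℕ) :
    Real.sqrt (wt i (up i a)) * phiMap d x (up i a) = x i * phiMap d x a := by
  classical
  have hsum : ∑ j, up i a j = (∑ j, a j) + 1 := by
    simp [up, Finset.sum_add_distrib, Finsupp.single_apply]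
  have hprod : ∀ (f : Fin d → ℕ → ℝ) (c : ℝ), f i (a i + 1) = c * f i (a i) →
      ∏ j, f j (up i a j) = c * ∏ j, f j (a j) := by
    intro f c h
    rw [← Finset.mul_prod_erase _ _ (Finset.mem_univ i),
      ← Finset.mul_prod_erase _ (fun j => f j (a j)) (Finset.mem_univ i), ← mul_assoc, ← h]
    congr 1
    · simp [up]
    · apply Finset.prod_congr rfl
      intro j hj
      simp [up, Finsupp.single_apply, (Finset.ne_of_mem_erase hj).symm]
  have hx := hprod (fun j n => x j ^ n) (x i) (by simp [pow_succ, mul_comm])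
  have hf := hprod (fun j n => (n.factorial : ℝ)) (a i + 1) (by simp [Nat.factorial_succ])
  have m1 := Nat.multinomial_spec Finset.univ (a : Fin d → ℕ)
  have m2 := Nat.multinomial_spec Finset.univ (up i a : Fin d → ℕ)
  rw [hsum, Nat.factorial_succ] at m2
  have m1' : (∏ j, ((a j).factorial : ℝ)) * (Nat.multinomial Finset.univ a : ℝ)
    = ((∑ j, a j).factorial : ℝ) := by exact_mod_cast m1
  have m2' : (∏ j, ((up i a j).factorial : ℝ)) * (Nat.multinomial Finset.univ (up i a) : ℝ)
    = (((∑ j, a j : ℕ) : ℝ) + 1) * ((∑ j, a j).factorial : ℝ) := by exact_mod_cast m2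
  have hup : ((up i a) i : ℝ) = a i + 1 := by simp [up]
  have hP : 0 < ∏ j, ((a j).factorial : ℝ) :=
    Finset.prod_pos fun j _ => by exact_mod_cast Nat.factorial_pos _
  simp only at hf hx
  rw [hf, ← m1'] at m2'
  have key : wt i (up i a) * (((2 : ℝ) ^ (∑ j, up i a j))⁻¹ * (Nat.multinomial Finset.univ (up i a) : ℝ))
      = ((2 : ℝ) ^ (∑ j, a j))⁻¹ * (Nat.multinomial Finset.univ a : ℝ) := by
    have m3 : ((a i : ℝ) + 1) * (Nat.multinomial Finset.univ (up i a) : ℝ) =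
        (((∑ j, a j : ℕ) : ℝ) + 1) * (Nat.multinomial Finset.univ a : ℝ) := by
      apply mul_left_cancel₀ hP.ne'
      linarith
    unfold wt
    rw [hsum, hup, pow_succ]
    have : (((∑ j, a j : ℕ) : ℝ) + 1) ≠ 0 := by positivity
    push_cast at this m3 ⊢
    field_simp
    linarith
  unfold phiMap
  rw [← key, Real.sqrt_mul (wt_nonneg _ _), hx]
  ring

/-- `f` acts as a diagonal multiplier of norm at most `C`. -/
def Good {d T : ℕ} (Φ : Fin T → HH d) (f : Fin T → ℝ) (C : ℝ) : Prop :=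
  ∃ M : HH d →L[ℝ] HH d, ‖M‖ ≤ C ∧ ∀ t, M (Φ t) = f t • Φ t

section good
variable {d T : ℕ} {Φ : Fin T → HH d} {f g : Fin T → ℝ} {C B : ℝ}

lemma Good.nonneg (h : Good Φ f C) : 0 ≤ C := by
  obtain ⟨M, h, _⟩ := h
  exact (norm_nonneg M).trans h

lemma Good.mono (h : Good Φ f C) (hB : C ≤ B) : Good Φ f B := by
  obtain ⟨M, h, h'⟩ := h
  exact ⟨M, h.trans hB, h'⟩

lemma Good.const (c : ℝ) : Good Φ (fun _ => c) |c| := by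
  refine ⟨c • ContinuousLinearMap.id ℝ _, ?_, fun t => by simp⟩
  rw [norm_smul]
  exact mul_le_of_le_one_right (abs_nonneg c) ContinuousLinearMap.norm_id_le

lemma Good.add (hf : Good Φ f C) (hg : Good Φ g B) : Good Φ (fun t => f t + g t) (C + B) := by
  obtain ⟨M, h1, h2⟩ := hf
  obtain ⟨N, h3, h4⟩ := hg
  exact ⟨M + N, (norm_add_le _ _).trans (add_le_add h1 h3), fun t => by simp [h2, h4, add_smul]⟩

lemma Good.mul (hf : Good Φ f C) (hg : Good Φ g B) : Good Φ (fun t => f t * g t) (C * B) := by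
  have hC := hf.nonneg
  obtain ⟨M, h1, h2⟩ := hf
  obtain ⟨N, h3, h4⟩ := hg
  refine ⟨M.comp N, (ContinuousLinearMap.opNorm_comp_le _ _).trans
    (mul_le_mul h1 h3 (norm_nonneg _) hC), fun t => ?_⟩
  simp [h2, h4, smul_smul, mul_comm]

lemma Good.neg (hf : Good Φ f C) : Good Φ (fun t => - f t) C := by
  obtain ⟨M, h1, h2⟩ := hf
  exact ⟨-M, by rwa [norm_neg], fun t => by simp [h2]⟩

lemma Good.sub (hf : Good Φ f C) (hg : Good Φ g B) : Good Φ (fun t => f t - g t) (C + B) := by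
  simpa only [sub_eq_add_neg] using hf.add hg.neg

lemma Good.pow (hf : Good Φ f C) (n : ℕ) : Good Φ (fun t => f t ^ n) (C ^ n) := by
  induction n with
  | zero => simpa using Good.const (Φ := Φ) 1
  | succ n ih => simpa only [pow_succ] using ih.mul hf

lemma Good.sum {ι : Type*} (S : Finset ι) (F : ι → Fin T → ℝ) (hF : ∀ i ∈ S, Good Φ (F i) C) :
    Good Φ (fun t => ∑ i ∈ S, F i t) (S.card * C) := by
  classical
  induction S using Finset.induction_on with
  | empty => simpa using Good.const (Φ := Φ) 0
  | insert i S hi ih =>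
    have := (hF i (Finset.mem_insert_self i S)).add
      (ih fun j hj => hF j (Finset.mem_insert_of_mem hj))
    simp only [Finset.sum_insert hi, Finset.card_insert_of_notMem hi]
    refine this.mono (le_of_eq ?_)
    push_cast; ring

lemma Good.prod {ι : Type*} (S : Finset ι) (F : ι → Fin T → ℝ) (hF : ∀ i ∈ S, Good Φ (F i) C) :
    Good Φ (fun t => ∏ i ∈ S, F i t) (C ^ S.card) := by
  classical
  induction S using Finset.induction_on with
  | empty => simpa using Good.const (Φ := Φ) 1
  | insert i S hi ih =>
    have := (hF i (Finset.mem_insert_self i S)).mul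
      (ih fun j hj => hF j (Finset.mem_insert_of_mem hj))
    simp only [Finset.prod_insert hi, Finset.card_insert_of_notMem hi]
    refine this.mono (le_of_eq ?_)
    ring

end good

lemma Good.linear {d T : ℕ} {Φ : Fin T → HH d} (x : Fin T → EuclideanSpace ℝ (Fin d))
    (hΦ : ∀ t, (Φ t : (Fin d →₀ ℕ) → ℝ) = phiMap d (x t)) (u : EuclideanSpace ℝ (Fin d)) :
    Good Φ (fun t => ⟪x t, u⟫) (Real.sqrt 2 * ‖u‖) := by
  refine ⟨(shL u).mkContinuous _ (shL_norm u), LinearMap.mkContinuous_norm_le _ (by positivity) _, ?_⟩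
  intro t
  ext a
  simp only [LinearMap.mkContinuous_apply, lp.coeFn_smul, Pi.smul_apply, smul_eq_mul]
  change shf u (Φ t) a = _
  unfold shf
  rw [hΦ t]
  simp only [phi_up]
  rw [PiLp.inner_apply, Finset.sum_mul]
  apply Finset.sum_congr rfl
  intro i _
  simp
  ring

lemma Good.repr {d T : ℕ} {Φ : Fin T → HH d} (x : Fin T → EuclideanSpace ℝ (Fin d))
    (hΦ : ∀ t, (Φ t : (Fin d →₀ ℕ) → ℝ) = phiMap d (x t)) {f : Fin T → ℝ} {C : ℝ}
    (h : Good Φ f C) : ∃ c : HH d, ‖c‖ ≤ C ∧ ∀ t, ⟪Φ t, c⟫ = f t := by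
  classical
  obtain ⟨M, h1, h2⟩ := h
  refine ⟨ContinuousLinearMap.adjoint M (lp.single 2 0 (1 : ℝ)), ?_, fun t => ?_⟩
  · refine (ContinuousLinearMap.le_opNorm _ _).trans ?_
    rw [LinearIsometryEquiv.norm_map, lp.norm_single (by norm_num)]
    simpa using h1
  · rw [ContinuousLinearMap.adjoint_inner_right, h2, lp.inner_single_right]
    simp [hΦ, phiMap, Nat.multinomial]

lemma strong_of_good {d K T : ℕ} (hK : 2 ≤ K) {Φ : Fin T → HH d}
    (x : Fin T → EuclideanSpace ℝ (Fin d))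
    (hΦ : ∀ t, (Φ t : (Fin d →₀ ℕ) → ℝ) = phiMap d (x t)) (y : Fin T → Fin K)
    (F : Fin K → Fin T → ℝ) {C g : ℝ} (hC : 0 < C) (hF : ∀ i, Good Φ (F i) C)
    (hpos : ∀ t, 1 / 2 ≤ F (y t) t) (hneg : ∀ t i, i ≠ y t → F i t ≤ - (1 / 2))
    (hg : g * (Real.sqrt K * C) ≤ 1) : StronglySeparable Φ y g := by
  choose c hc1 hc2 using fun i => (hF i).repr x hΦ
  have hK0 : (0 : ℝ) < K := by exact_mod_cast (by omega : 0 < K)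
  have hS : 0 < Real.sqrt K * C := by positivity
  have hg' : g ≤ (Real.sqrt K * C)⁻¹ := by
    rw [← one_div, le_div_iff₀ hS]; exact hg
  refine ⟨fun i => (Real.sqrt K * C)⁻¹ • c i, ?_, fun t => ?_, fun t i hi => ?_⟩
  · have : ∀ i ∈ (Finset.univ : Finset (Fin K)), ‖(Real.sqrt K * C)⁻¹ • c i‖ ^ 2 ≤ (K : ℝ)⁻¹ := by
      intro i _
      rw [norm_smul, mul_pow, Real.norm_eq_abs, sq_abs, inv_pow, mul_pow, Real.sq_sqrt hK0.le]
      have : ‖c i‖ ^ 2 ≤ C ^ 2 := pow_le_pow_left₀ (norm_nonneg _) (hc1 i) 2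
      rw [inv_mul_le_iff₀ (by positivity)]
      field_simp
      exact this
    refine (Finset.sum_le_sum this).trans ?_
    simp [hK0.ne']
  · rw [inner_smul_right, hc2]
    have := mul_le_mul_of_nonneg_left (hpos t) (inv_pos.2 hS).le
    linarith
  · rw [inner_smul_right, hc2]
    have := mul_le_mul_of_nonneg_left (hneg t i hi) (inv_pos.2 hS).le
    linarith

/-- Chebyshev polynomials of the first kind as functions. -/
noncomputable def Ch : ℕ → ℝ → ℝ
  | 0, _ => 1
  | 1, x => x
  | (n + 2), x => 2 * x * Ch (n + 1) x - Ch n x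

lemma Ch_cos (n : ℕ) (θ : ℝ) : Ch n (Real.cos θ) = Real.cos (n * θ) := by
  induction n using Nat.twoStepInduction with
  | zero => simp [Ch]
  | one => simp [Ch]
  | more n h1 h2 =>
    rw [Ch, h1, h2]
    have e1 : ((n + 2 : ℕ) : ℝ) * θ = ((n + 1 : ℕ) : ℝ) * θ + θ := by push_cast; ring
    have e2 : (n : ℝ) * θ = ((n + 1 : ℕ) : ℝ) * θ - θ := by push_cast; ring
    rw [e1, e2, Real.cos_add, Real.cos_sub]
    ring

lemma Ch_abs (n : ℕ) (x : ℝ) (h1 : -1 ≤ x) (h2 : x ≤ 1) : |Ch n x| ≤ 1 := by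
  rw [← Real.cos_arccos h1 h2, Ch_cos]
  exact Real.abs_cos_le_one _

lemma Ch_lower_aux (n : ℕ) (a : ℝ) (ha : 0 ≤ a) :
    1 + (n : ℝ) ^ 2 * a ≤ Ch n (1 + a) ∧ (2 * n + 1) * a ≤ Ch (n + 1) (1 + a) - Ch n (1 + a) := by
  induction n with
  | zero => simp [Ch]
  | succ n ih =>
    obtain ⟨h1, h2⟩ := ih
    have h3 : 1 + ((n + 1 : ℕ) : ℝ) ^ 2 * a ≤ Ch (n + 1) (1 + a) := by
      push_cast; nlinarith
    refine ⟨h3, ?_⟩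
    rw [Ch]
    have h4 : 1 ≤ Ch (n + 1) (1 + a) := by
      have : 0 ≤ ((n + 1 : ℕ) : ℝ) ^ 2 * a := by positivity
      linarith
    push_cast
    nlinarith

lemma Ch_good {d T : ℕ} {Φ : Fin T → HH d} {f : Fin T → ℝ} (hf : Good Φ f 2) (n : ℕ) :
    Good Φ (fun t => Ch n (f t)) (5 ^ n) := by
  induction n using Nat.twoStepInduction with
  | zero => simpa [Ch] using Good.const (Φ := Φ) 1
  | one => simpa [Ch] using hf.mono (by norm_num)
  | more n h1 h2 =>
    have := (((Good.const (Φ := Φ) 2).mul hf).mul h2).sub h1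
    refine this.mono ?_
    have h5 : (0 : ℝ) < 5 ^ n := by positivity
    rw [abs_of_pos (by norm_num : (0 : ℝ) < 2), pow_succ, pow_succ, pow_succ]
    linarith

/-- The polynomials used in the rational approximation of the sign. -/
noncomputable def Pf : ℕ → ℝ → ℝ
  | 0, z => z - 1
  | (s + 1), z => Pf s z * (z / 2 ^ (s + 1) - 1) ^ 2

lemma Pf_neg_ge (s : ℕ) (z : ℝ) (hz : 0 ≤ z) : 1 ≤ |Pf s (-z)| ∧ |Pf s z| ≤ |Pf s (-z)| := by
  induction s with
  | zero =>
    simp only [Pf]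
    rw [abs_of_nonpos (by linarith : -z - 1 ≤ 0)]
    refine ⟨by linarith, abs_le.2 ⟨by linarith, by linarith⟩⟩
  | succ s ih =>
    simp only [Pf, abs_mul, abs_pow, sq_abs]
    have h : 0 ≤ z / 2 ^ (s + 1) := by positivity
    rw [neg_div]
    generalize z / 2 ^ (s + 1) = u at h
    constructor
    · exact one_le_mul_of_one_le_of_one_le ih.1 (by nlinarith)
    · exact mul_le_mul ih.2 (by nlinarith) (sq_nonneg _) (abs_nonneg _)

lemma Pf_ratio (s : ℕ) (z : ℝ) (hz : 1 ≤ z) (hz' : z ≤ 2 ^ s) : 4 * |Pf s z| ≤ |Pf s (-z)| := by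
  induction s with
  | zero =>
    have : z = 1 := le_antisymm (by simpa using hz') hz
    subst this
    simp [Pf]
  | succ s ih =>
    simp only [Pf, abs_mul, abs_pow, sq_abs]
    have h : 0 ≤ z / 2 ^ (s + 1) := by positivity
    have h1 : z / 2 ^ (s + 1) ≤ 1 := (div_le_one (by positivity)).2 hz'
    rw [neg_div]
    rcases le_total z (2 ^ s) with h2 | h2
    · generalize z / 2 ^ (s + 1) = u at h h1
      rw [← mul_assoc]
      exact mul_le_mul (ih h2) (by nlinarith) (sq_nonneg _) (abs_nonneg _)
    · have h3 : 1 / 2 ≤ z / 2 ^ (s + 1) := by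
        rw [le_div_iff₀ (by positivity), pow_succ]; linarith
      have h4 := (Pf_neg_ge s z (by linarith)).2
      generalize z / 2 ^ (s + 1) = u at h h1 h3
      have : |Pf s z| * (4 * (u - 1) ^ 2) ≤ |Pf s (-z)| * (-u - 1) ^ 2 :=
        mul_le_mul h4 (by nlinarith) (by positivity) (abs_nonneg _)
      linarith

lemma Pf_good {d T : ℕ} {Φ : Fin T → HH d} {f : Fin T → ℝ} (S : ℕ) (hf : Good Φ f (2 ^ S))
    (s : ℕ) (hs : s ≤ S) :
    Good Φ (fun t => Pf s (f t)) (2 ^ (S + 1) * 2 ^ (s * (2 * S + 1 - s))) := by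
  induction s with
  | zero =>
    refine (hf.sub (Good.const (Φ := Φ) 1)).mono ?_
    have : (1 : ℝ) ≤ 2 ^ S := one_le_pow₀ (by norm_num)
    simp [pow_succ]; linarith
  | succ s ih =>
    have h1 := (ih (by omega)).mul
      (((hf.mul (Good.const (Φ := Φ) ((2 : ℝ) ^ (s + 1))⁻¹)).sub (Good.const (Φ := Φ) 1)).pow 2)
    have h2 : Good Φ (fun t => Pf (s + 1) (f t))
        (2 ^ (S + 1) * 2 ^ (s * (2 * S + 1 - s)) *
          (2 ^ S * |((2 : ℝ) ^ (s + 1))⁻¹| + |1|) ^ 2) := by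
      simpa only [Pf, div_eq_mul_inv] using h1
    refine h2.mono ?_
    obtain ⟨k, rfl⟩ : ∃ k, S = s + 1 + k := ⟨S - (s + 1), by omega⟩
    have e1 : (2 : ℝ) ^ (s + 1 + k) * |((2 : ℝ) ^ (s + 1))⁻¹| = 2 ^ k := by
      rw [abs_of_pos (by positivity), pow_add _ (s + 1)]
      field_simp
    rw [e1, mul_assoc]
    apply mul_le_mul_of_nonneg_left _ (by positivity)
    have e2 : (2 : ℝ) ^ k + |1| ≤ 2 ^ (k + 1) := by
      have : (1 : ℝ) ≤ 2 ^ k := one_le_pow₀ (by norm_num)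
      rw [pow_succ, abs_one]; linarith
    have e3 : ((2 : ℝ) ^ k + |1|) ^ 2 ≤ (2 ^ (k + 1)) ^ 2 := by gcongr
    refine (mul_le_mul_of_nonneg_left e3 (by positivity)).trans ?_
    rw [← pow_mul, ← pow_add]
    apply le_of_eq
    congr 1
    rw [show 2 * (s + 1 + k) + 1 - s = s + 3 + 2 * k by omega,
      show 2 * (s + 1 + k) + 1 - (s + 1) = s + 2 + 2 * k by omega]
    ring

lemma Pf_good' {d T : ℕ} {Φ : Fin T → HH d} {f : Fin T → ℝ} (s : ℕ) (hf : Good Φ f (2 ^ s)) :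
    Good Φ (fun t => Pf s (f t)) (2 ^ ((s + 1) ^ 2)) := by
  refine (Pf_good s hf s le_rfl).mono (le_of_eq ?_)
  rw [← pow_add]
  congr 1
  rw [show 2 * s + 1 - s = s + 1 by omega]
  ring

lemma z_facts {d K T : ℕ} {γ : ℝ} (x : Fin T → EuclideanSpace ℝ (Fin d)) (y : Fin T → Fin K)
    (hx : ∀ t, ‖x t‖ ≤ 1) (w : Fin K → EuclideanSpace ℝ (Fin d)) (hw : ∑ i, ‖w i‖ ^ 2 ≤ 1)
    (hsep : ∀ t : Fin T, ∀ i : Fin K, i ≠ y t → ⟪x t, w (y t)⟫ ≥ ⟪x t, w i⟫ + γ) :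
    (∀ i j, i ≠ j → Real.sqrt 2 * ‖w i - w j‖ ≤ 2) ∧
    (∀ i j, i ≠ j → ∀ t, |⟪x t, w i - w j⟫| ≤ 2) ∧
    (∀ t j, j ≠ y t → γ ≤ ⟪x t, w (y t) - w j⟫) ∧
    (∀ t i, i ≠ y t → ⟪x t, w i - w (y t)⟫ ≤ -γ) := by
  have h1 : ∀ i j, i ≠ j → ‖w i - w j‖ ≤ Real.sqrt 2 := by
    intro i j hij
    apply Real.le_sqrt_of_sq_le
    have a1 : ‖w i‖ ^ 2 + ‖w j‖ ^ 2 ≤ 1 := by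
      refine le_trans ?_ hw
      rw [← Finset.sum_pair (f := fun i => ‖w i‖ ^ 2) hij]
      exact Finset.sum_le_sum_of_subset_of_nonneg (Finset.subset_univ _)
        (fun _ _ _ => sq_nonneg _)
    have a2 := norm_sub_le (w i) (w j)
    nlinarith [norm_nonneg (w i - w j), sq_nonneg (‖w i‖ - ‖w j‖), norm_nonneg (w i),
      norm_nonneg (w j)]
  have hs2 : Real.sqrt 2 * Real.sqrt 2 = 2 := Real.mul_self_sqrt (by norm_num)
  have h0 := Real.sqrt_nonneg 2
  refine ⟨fun i j hij => ?_, fun i j hij t => ?_, fun t j hj => ?_, fun t i hi => ?_⟩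
  · nlinarith [h1 i j hij]
  · have := abs_real_inner_le_norm (x t) (w i - w j)
    have h3 := h1 i j hij
    have h4 : Real.sqrt 2 ≤ 2 := by nlinarith
    nlinarith [hx t, norm_nonneg (x t), norm_nonneg (w i - w j)]
  · rw [inner_sub_right]; linarith [hsep t j hj]
  · rw [inner_sub_right]; linarith [hsep t i hi]

lemma strong_one {d K T : ℕ} (hK : 2 ≤ K) (γ : ℝ) (hγ : 0 < γ)
    (x : Fin T → EuclideanSpace ℝ (Fin d)) (y : Fin T → Fin K)
    (hx : ∀ t, ‖x t‖ ≤ 1) (hweak : WeaklySeparable x y γ) {Φ : Fin T → HH d}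
    (hΦ : ∀ t, (Φ t : (Fin d →₀ ℕ) → ℝ) = phiMap d (x t)) (L M : ℕ)
    (hL : 2 * ((K : ℝ) - 1) ≤ 2 ^ L) (hM : 2 / γ ≤ (M : ℝ) ^ 2) {g : ℝ}
    (hg : g * (Real.sqrt K * (((K : ℝ) - 1) + 1 / 2 + ((K : ℝ) - 1) * (5 ^ M) ^ L)) ≤ 1) :
    StronglySeparable Φ y g := by
  classical
  obtain ⟨w, hw, hsep⟩ := hweak
  obtain ⟨h1, h2, h3, h4⟩ := z_facts x y hx w hw hsep
  have hK1 : (2 : ℝ) ≤ K := by exact_mod_cast hK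
  have hcard : ∀ i : Fin K, (((Finset.univ.erase i).card : ℕ) : ℝ) = (K : ℝ) - 1 := by
    intro i
    rw [Finset.card_erase_of_mem (Finset.mem_univ i), Finset.card_univ, Fintype.card_fin,
      Nat.cast_sub (by omega)]
    simp
  have hM' : 2 ≤ 1 + (M : ℝ) ^ 2 * (γ / 2) := by
    rw [div_le_iff₀ hγ] at hM; linarith
  have hlow : ∀ i j, i ≠ j → ∀ t, -1 ≤ Ch M (1 - ⟪x t, w i - w j⟫ / 2) ^ L := by
    intro i j hij t
    have := abs_le.1 (h2 i j hij t)
    rcases le_total 0 (⟪x t, w i - w j⟫) with h | h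
    · have hc := Ch_abs M (1 - ⟪x t, w i - w j⟫ / 2) (by linarith) (by linarith)
      have : |Ch M (1 - ⟪x t, w i - w j⟫ / 2) ^ L| ≤ 1 := by
        rw [abs_pow]; exact pow_le_one₀ (abs_nonneg _) hc
      exact (abs_le.1 this).1
    · have hc := (Ch_lower_aux M (-⟪x t, w i - w j⟫ / 2) (by linarith)).1
      have e : 1 + -⟪x t, w i - w j⟫ / 2 = 1 - ⟪x t, w i - w j⟫ / 2 := by ring
      rw [e] at hc
      have : 0 ≤ (M : ℝ) ^ 2 * (-⟪x t, w i - w j⟫ / 2) := mul_nonneg (sq_nonneg _) (by linarith)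
      have : 0 ≤ Ch M (1 - ⟪x t, w i - w j⟫ / 2) ^ L := pow_nonneg (by linarith) _
      linarith
  refine strong_of_good hK x hΦ y (fun i t => (((K : ℝ) - 1) + 1 / 2) -
    ∑ j ∈ Finset.univ.erase i, Ch M (1 - ⟪x t, w i - w j⟫ / 2) ^ L)
    (C := ((K : ℝ) - 1) + 1 / 2 + ((K : ℝ) - 1) * (5 ^ M) ^ L) ?_ ?_ ?_ ?_ hg
  · have : 0 ≤ ((K : ℝ) - 1) * (5 ^ M) ^ L := mul_nonneg (by linarith) (by positivity)
    linarith
  · intro i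
    have hgood := Good.sum (Φ := Φ) (C := ((5 : ℝ) ^ M) ^ L) (Finset.univ.erase i)
      (fun j t => Ch M (1 - ⟪x t, w i - w j⟫ / 2) ^ L) (fun j hj => by
        refine (Ch_good ?_ M).pow L
        have hl := (Good.linear x hΦ (w i - w j)).mono (h1 i j (Finset.ne_of_mem_erase hj).symm)
        have := (Good.const (Φ := Φ) 1).sub (hl.mul (Good.const (Φ := Φ) (1 / 2)))
        simp only [mul_one_div] at this
        exact this.mono (by norm_num [abs_of_pos]))
    rw [hcard] at hgood
    refine ((Good.const (Φ := Φ) (((K : ℝ) - 1) + 1 / 2)).sub hgood).mono (le_of_eq ?_)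
    rw [abs_of_pos (by linarith)]
  · intro t
    have : ∑ j ∈ Finset.univ.erase (y t), Ch M (1 - ⟪x t, w (y t) - w j⟫ / 2) ^ L ≤
        ∑ j ∈ Finset.univ.erase (y t), (1 : ℝ) := by
      apply Finset.sum_le_sum
      intro j hj
      have hj' := Finset.ne_of_mem_erase hj
      have a1 := h3 t j hj'
      have a2 := abs_le.1 (h2 _ _ hj'.symm t)
      have hc := Ch_abs M (1 - ⟪x t, w (y t) - w j⟫ / 2) (by linarith) (by linarith)
      refine (le_abs_self _).trans ?_
      rw [abs_pow]; exact pow_le_one₀ (abs_nonneg _) hc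
    rw [Finset.sum_const, nsmul_eq_mul, hcard] at this
    linarith
  · intro t i hi
    have hmem : y t ∈ Finset.univ.erase i := Finset.mem_erase.2 ⟨hi.symm, Finset.mem_univ _⟩
    have hbig : 2 * ((K : ℝ) - 1) ≤ Ch M (1 - ⟪x t, w i - w (y t)⟫ / 2) ^ L := by
      refine hL.trans (pow_le_pow_left₀ (by norm_num) ?_ L)
      have a1 := h4 t i hi
      have hc := (Ch_lower_aux M (-⟪x t, w i - w (y t)⟫ / 2) (by linarith)).1
      have e : 1 + -⟪x t, w i - w (y t)⟫ / 2 = 1 - ⟪x t, w i - w (y t)⟫ / 2 := by ring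
      rw [e] at hc
      have : (M : ℝ) ^ 2 * (γ / 2) ≤ (M : ℝ) ^ 2 * (-⟪x t, w i - w (y t)⟫ / 2) :=
        mul_le_mul_of_nonneg_left (by linarith) (sq_nonneg _)
      linarith
    have hrest : ∑ j ∈ (Finset.univ.erase i).erase (y t), (-1 : ℝ) ≤
        ∑ j ∈ (Finset.univ.erase i).erase (y t), Ch M (1 - ⟪x t, w i - w j⟫ / 2) ^ L :=
      Finset.sum_le_sum fun j hj =>
        hlow i j (Finset.ne_of_mem_erase (Finset.mem_of_mem_erase hj)).symm t
    rw [Finset.sum_const, nsmul_eq_mul, Finset.card_erase_of_mem hmem,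
      Nat.cast_sub (Finset.card_pos.2 ⟨_, hmem⟩), hcard] at hrest
    rw [← Finset.add_sum_erase _ _ hmem]
    push_cast at hrest
    linarith

lemma sgn_facts (s q : ℕ) (m z : ℝ) (hm : 1 ≤ m) (hq : 4 * m + 1 ≤ 4 ^ (2 * q)) :
    1 ≤ Pf s (-z) ^ (2 * q) + Pf s z ^ (2 * q) ∧
    |Pf s (-z) ^ (2 * q) - Pf s z ^ (2 * q)| ≤ Pf s (-z) ^ (2 * q) + Pf s z ^ (2 * q) ∧
    (1 ≤ z → z ≤ 2 ^ s → (1 - 1 / (2 * m + 1)) * (Pf s (-z) ^ (2 * q) + Pf s z ^ (2 * q)) ≤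
      Pf s (-z) ^ (2 * q) - Pf s z ^ (2 * q)) ∧
    (z ≤ -1 → -z ≤ 2 ^ s → Pf s (-z) ^ (2 * q) - Pf s z ^ (2 * q) ≤
      -((1 - 1 / (2 * m + 1)) * (Pf s (-z) ^ (2 * q) + Pf s z ^ (2 * q)))) := by
  have hnn : ∀ v : ℝ, 0 ≤ v ^ (2 * q) := fun v => by rw [pow_mul]; positivity
  have hone : ∀ v : ℝ, 0 ≤ v → 1 ≤ Pf s (-v) ^ (2 * q) := by
    intro v hv
    rw [← Even.pow_abs (even_two_mul q)]
    exact one_le_pow₀ (Pf_neg_ge s v hv).1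
  have hrat : ∀ v : ℝ, 1 ≤ v → v ≤ 2 ^ s →
      (4 * m + 1) * Pf s v ^ (2 * q) ≤ Pf s (-v) ^ (2 * q) := by
    intro v h1 h2
    have := pow_le_pow_left₀ (by positivity) (Pf_ratio s v h1 h2) (2 * q)
    rw [mul_pow, Even.pow_abs (even_two_mul q), Even.pow_abs (even_two_mul q)] at this
    exact (mul_le_mul_of_nonneg_right hq (hnn _)).trans this
  have hcalc : ∀ A B : ℝ, (4 * m + 1) * B ≤ A → (1 - 1 / (2 * m + 1)) * (A + B) ≤ A - B := by
    intro A B h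
    have h0 : 0 < 2 * m + 1 := by linarith
    have e : 1 - 1 / (2 * m + 1) = 2 * m / (2 * m + 1) := by field_simp; ring
    rw [e, div_mul_eq_mul_div, div_le_iff₀ h0]
    nlinarith
  refine ⟨?_, ?_, fun h1 h2 => hcalc _ _ (hrat z h1 h2), fun h1 h2 => ?_⟩
  · rcases le_total 0 z with h | h
    · linarith [hone z h, hnn (Pf s z)]
    · have := hone (-z) (by linarith)
      rw [neg_neg] at this
      linarith [hnn (Pf s (-z))]
  · rw [abs_le]
    constructor <;> linarith [hnn (Pf s z), hnn (Pf s (-z))]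
  · have := hrat (-z) (by linarith) h2
    rw [neg_neg] at this
    have := hcalc _ _ this
    linarith

lemma strong_two {d K T : ℕ} (hK : 2 ≤ K) (γ : ℝ) (hγ : 0 < γ)
    (x : Fin T → EuclideanSpace ℝ (Fin d)) (y : Fin T → Fin K)
    (hx : ∀ t, ‖x t‖ ≤ 1) (hweak : WeaklySeparable x y γ) {Φ : Fin T → HH d}
    (hΦ : ∀ t, (Φ t : (Fin d →₀ ℕ) → ℝ) = phiMap d (x t)) (s q : ℕ)
    (hs : 2 / γ ≤ 2 ^ s) (hq : 4 * ((K : ℝ) - 1) + 1 ≤ 4 ^ (2 * q)) {g : ℝ}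
    (hg : g * (Real.sqrt K * (2 * ((K : ℝ) - 1) *
      (2 * (2 ^ ((s + 1) ^ 2)) ^ (2 * q)) ^ (K - 1))) ≤ 1) :
    StronglySeparable Φ y g := by
  classical
  obtain ⟨w, hw, hsep⟩ := hweak
  obtain ⟨h1, h2, h3, h4⟩ := z_facts x y hx w hw hsep
  have hK1 : (2 : ℝ) ≤ K := by exact_mod_cast hK
  have hcardN : ∀ i : Fin K, (Finset.univ.erase i).card = K - 1 := by
    intro i
    rw [Finset.card_erase_of_mem (Finset.mem_univ i), Finset.card_univ, Fintype.card_fin]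
  have hcast : ((K - 1 : ℕ) : ℝ) = (K : ℝ) - 1 := by
    rw [Nat.cast_sub (by omega)]; simp
  set m : ℝ := (K : ℝ) - 1 with hm
  have hm1 : 1 ≤ m := by linarith
  set z : Fin K → Fin K → Fin T → ℝ := fun i j t => ⟪x t, w i - w j⟫ * γ⁻¹ with hz
  have hzabs : ∀ i j, i ≠ j → ∀ t, |z i j t| ≤ 2 ^ s := by
    intro i j hij t
    refine le_trans ?_ hs
    rw [hz]
    simp only
    rw [abs_mul, abs_of_pos (inv_pos.2 hγ), div_eq_mul_inv]
    exact mul_le_mul_of_nonneg_right (h2 i j hij t) (inv_pos.2 hγ).le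
  set A : Fin K → Fin K → Fin T → ℝ := fun i j t => Pf s (- z i j t) ^ (2 * q) with hA
  set B : Fin K → Fin K → Fin T → ℝ := fun i j t => Pf s (z i j t) ^ (2 * q) with hB
  set G : ℝ := 2 * (2 ^ ((s + 1) ^ 2)) ^ (2 * q) with hG
  have hG0 : 0 < G := by positivity
  have hzg : ∀ i j, i ≠ j → Good Φ (z i j) (2 ^ s) := by
    intro i j hij
    have := ((Good.linear x hΦ (w i - w j)).mono (h1 i j hij)).mul (Good.const (Φ := Φ) γ⁻¹)
    refine this.mono ?_
    rw [abs_of_pos (inv_pos.2 hγ), ← div_eq_mul_inv]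
    exact hs
  have hAg : ∀ i j, i ≠ j → Good Φ (A i j) ((2 ^ ((s + 1) ^ 2)) ^ (2 * q)) := fun i j hij =>
    (Pf_good' s (hzg i j hij).neg).pow _
  have hBg : ∀ i j, i ≠ j → Good Φ (B i j) ((2 ^ ((s + 1) ^ 2)) ^ (2 * q)) := fun i j hij =>
    (Pf_good' s (hzg i j hij)).pow _
  have hadd : ∀ i j, i ≠ j → Good Φ (fun t => A i j t + B i j t) G := fun i j hij =>
    ((hAg i j hij).add (hBg i j hij)).mono (le_of_eq (by rw [hG]; ring))
  have hsub : ∀ i j, i ≠ j → Good Φ (fun t => A i j t - B i j t) G := fun i j hij =>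
    ((hAg i j hij).sub (hBg i j hij)).mono (le_of_eq (by rw [hG]; ring))
  have hfac : ∀ i t, ∑ j ∈ Finset.univ.erase i, (A i j t - B i j t) *
      ∏ k ∈ (Finset.univ.erase i).erase j, (A i k t + B i k t) -
      (m - 1) * ∏ k ∈ Finset.univ.erase i, (A i k t + B i k t) =
      (∏ k ∈ Finset.univ.erase i, (A i k t + B i k t)) *
      (∑ j ∈ Finset.univ.erase i, (A i j t - B i j t) / (A i j t + B i j t) - (m - 1)) := by
    intro i t
    rw [mul_sub, Finset.mul_sum, mul_comm (m - 1)]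
    congr 1
    apply Finset.sum_congr rfl
    intro j hj
    rw [← Finset.mul_prod_erase _ _ hj]
    have := (sgn_facts s q m (z i j t) hm1 hq).1
    have : A i j t + B i j t ≠ 0 := by
      apply ne_of_gt
      exact lt_of_lt_of_le one_pos this
    field_simp
  have hD : ∀ i t, 1 ≤ ∏ k ∈ Finset.univ.erase i, (A i k t + B i k t) := fun i t =>
    Finset.prod_induction _ (fun v : ℝ => 1 ≤ v)
      (fun _ _ ha hb => one_le_mul_of_one_le_of_one_le ha hb) le_rfl fun k _ => (sgn_facts s q m (z i k t) hm1 hq).1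
  have hδ : m * (1 / (2 * m + 1)) ≤ 1 / 2 := by
    rw [mul_one_div, div_le_div_iff₀ (by linarith) (by norm_num)]; linarith
  have hδ0 : 0 ≤ 1 / (2 * m + 1) := by positivity
  refine strong_of_good hK x hΦ y (fun i t => ∑ j ∈ Finset.univ.erase i, (A i j t - B i j t) *
      ∏ k ∈ (Finset.univ.erase i).erase j, (A i k t + B i k t) -
      (m - 1) * ∏ k ∈ Finset.univ.erase i, (A i k t + B i k t))
    (C := 2 * m * G ^ (K - 1)) (by positivity) ?_ ?_ ?_ hg
  · intro i
    have g1 := Good.sum (Φ := Φ) (C := G ^ (K - 1)) (Finset.univ.erase i)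
      (fun j t => (A i j t - B i j t) *
        ∏ k ∈ (Finset.univ.erase i).erase j, (A i k t + B i k t)) (fun j hj => by
        refine ((hsub i j (Finset.ne_of_mem_erase hj).symm).mul
          (Good.prod _ _ fun k hk =>
            hadd i k (Finset.ne_of_mem_erase (Finset.mem_of_mem_erase hk)).symm)).mono
            (le_of_eq ?_)
        rw [Finset.card_erase_of_mem hj, hcardN, ← pow_succ']
        congr 1
        omega)
    have g2 := Good.prod (Φ := Φ) (C := G) (Finset.univ.erase i)
      (fun k t => A i k t + B i k t) (fun k hk => hadd i k (Finset.ne_of_mem_erase hk).symm)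
    refine (g1.sub ((Good.const (Φ := Φ) (m - 1)).mul g2)).mono ?_
    rw [hcardN, hcast, abs_of_nonneg (by linarith)]
    have : 0 < G ^ (K - 1) := by positivity
    linarith
  · intro t
    rw [hfac]
    have : ∑ j ∈ Finset.univ.erase (y t), (1 - 1 / (2 * m + 1)) ≤
        ∑ j ∈ Finset.univ.erase (y t), (A (y t) j t - B (y t) j t) / (A (y t) j t + B (y t) j t) := by
      apply Finset.sum_le_sum
      intro j hj
      have hj' := Finset.ne_of_mem_erase hj
      obtain ⟨f1, -, f3, -⟩ := sgn_facts s q m (z (y t) j t) hm1 hq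
      rw [le_div_iff₀ (lt_of_lt_of_le one_pos f1)]
      refine f3 ?_ (abs_le.1 (hzabs _ _ hj'.symm t)).2
      have := h3 t j hj'
      rw [hz]
      simp only
      rw [← div_eq_mul_inv, le_div_iff₀ hγ]
      linarith
    rw [Finset.sum_const, nsmul_eq_mul, hcardN, hcast] at this
    have h5 := hD (y t) t
    nlinarith
  · intro t i hi
    rw [hfac]
    have hmem : y t ∈ Finset.univ.erase i := Finset.mem_erase.2 ⟨hi.symm, Finset.mem_univ _⟩
    rw [← Finset.add_sum_erase _ (fun j => (A i j t - B i j t) / (A i j t + B i j t)) hmem]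
    have hbig : (A i (y t) t - B i (y t) t) / (A i (y t) t + B i (y t) t) ≤
        -(1 - 1 / (2 * m + 1)) := by
      obtain ⟨f1, -, -, f4⟩ := sgn_facts s q m (z i (y t) t) hm1 hq
      rw [div_le_iff₀ (lt_of_lt_of_le one_pos f1), neg_mul]
      refine f4 ?_ (by linarith [(abs_le.1 (hzabs _ _ hi t)).1])
      have := h4 t i hi
      rw [hz]
      simp only
      rw [← div_eq_mul_inv, div_le_iff₀ hγ]
      linarith
    have hrest : ∑ j ∈ (Finset.univ.erase i).erase (y t),
        (A i j t - B i j t) / (A i j t + B i j t) ≤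
        ∑ j ∈ (Finset.univ.erase i).erase (y t), (1 : ℝ) := by
      apply Finset.sum_le_sum
      intro j hj
      obtain ⟨f1, f2, -, -⟩ := sgn_facts s q m (z i j t) hm1 hq
      rw [div_le_one (lt_of_lt_of_le one_pos f1)]
      exact (le_abs_self _).trans f2
    rw [Finset.sum_const, nsmul_eq_mul, Finset.card_erase_of_mem hmem, hcardN,
      Nat.cast_sub (by omega), hcast] at hrest
    push_cast at hrest
    have hδ1 : 1 / (2 * m + 1) ≤ 1 / 2 := by nlinarith
    have h5 := hD i t
    nlinarith

lemma num_one (K L M : ℕ) (hK : 2 ≤ K) (hL1 : 1 ≤ L) (hM1 : 1 ≤ M)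
    (hL : 2 * ((K : ℝ) - 1) ≤ 2 ^ L) :
    (376 * ((L * M : ℕ) : ℝ)) ^ (-(((L * M : ℕ) : ℝ) / 2)) / (2 * Real.sqrt K) *
    (Real.sqrt K * (((K : ℝ) - 1) + 1 / 2 + ((K : ℝ) - 1) * (5 ^ M) ^ L)) ≤ 1 := by
  have hK1 : (2 : ℝ) ≤ K := by exact_mod_cast hK
  have hsK : 0 < Real.sqrt K := Real.sqrt_pos.2 (by linarith)
  set n := L * M with hn
  have hn1 : 1 ≤ n := Nat.mul_pos hL1 hM1
  have hn1' : (1 : ℝ) ≤ n := by exact_mod_cast hn1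
  have hLn : L ≤ n := Nat.le_mul_of_pos_right _ hM1
  have hX : (10 : ℝ) ^ n ≤ (376 * (n : ℝ)) ^ ((n : ℝ) / 2) := by
    calc (10 : ℝ) ^ n = ((10 : ℝ) ^ (2 : ℝ)) ^ ((n : ℝ) / 2) := by
          rw [← Real.rpow_mul (by norm_num), ← Real.rpow_natCast]
          congr 1; ring
      _ ≤ _ := by
          apply Real.rpow_le_rpow (by positivity) _ (by positivity)
          norm_num
          nlinarith
  rw [Real.rpow_neg (by positivity)]
  have hXp : 0 < (376 * (n : ℝ)) ^ ((n : ℝ) / 2) := lt_of_lt_of_le (by positivity) hX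
  set X := (376 * (n : ℝ)) ^ ((n : ℝ) / 2)
  have e : X⁻¹ / (2 * Real.sqrt K) *
    (Real.sqrt K * (((K : ℝ) - 1) + 1 / 2 + ((K : ℝ) - 1) * (5 ^ M) ^ L)) =
    (((K : ℝ) - 1) + 1 / 2 + ((K : ℝ) - 1) * (5 ^ M) ^ L) / (2 * X) := by
    field_simp
  rw [e, div_le_one (by positivity)]
  have hp : ((5 : ℝ) ^ M) ^ L = 5 ^ n := by rw [← pow_mul, hn, mul_comm]
  rw [hp]
  have h2 : (2 : ℝ) ^ L ≤ 2 ^ n := pow_le_pow_right₀ (by norm_num) hLn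
  have h3 : (10 : ℝ) ^ n = 2 ^ n * 5 ^ n := by rw [← mul_pow]; norm_num
  have h5 : (1 : ℝ) ≤ 5 ^ n := one_le_pow₀ (by norm_num)
  nlinarith

lemma num_two (K s q : ℕ) (hK : 2 ≤ K) :
    ((2 : ℝ) ^ (s + 1) * (2 * q + 1 : ℕ) * ((K : ℝ) - 1) * (4 * s + 2)) ^
        (-(((s : ℝ) + 1 / 2) * (2 * q + 1 : ℕ) * ((K : ℝ) - 1))) /
        (4 * Real.sqrt K * (4 * (K : ℝ) - 5) * 2 ^ (K - 1)) *
    (Real.sqrt K * (2 * ((K : ℝ) - 1) * (2 * (2 ^ ((s + 1) ^ 2)) ^ (2 * q)) ^ (K - 1))) ≤ 1 := by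
  have hK1 : (2 : ℝ) ≤ K := by exact_mod_cast hK
  have hsK : 0 < Real.sqrt K := Real.sqrt_pos.2 (by linarith)
  have hcast : ((K - 1 : ℕ) : ℝ) = (K : ℝ) - 1 := by
    rw [Nat.cast_sub (by omega)]; simp
  set m : ℝ := (K : ℝ) - 1 with hm
  have hm1 : 1 ≤ m := by linarith
  have hK5 : 4 * (K : ℝ) - 5 = 4 * m - 1 := by rw [hm]; ring
  rw [hK5]
  have hq1 : (1 : ℝ) ≤ (2 * q + 1 : ℕ) := by exact_mod_cast (by omega : 1 ≤ 2 * q + 1)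
  set ρ : ℝ := ((2 * q + 1 : ℕ) : ℝ) with hρ
  have hbase : (2 : ℝ) ^ (s + 2) ≤ 2 ^ (s + 1) * ρ * m * (4 * s + 2) := by
    have a1 : 1 ≤ ρ * m := by nlinarith
    have a2 : (2 : ℝ) ≤ 4 * s + 2 := by linarith [Nat.cast_nonneg (α := ℝ) s]
    have a3 : 2 ≤ ρ * m * (4 * s + 2) := by nlinarith
    have a4 : (0 : ℝ) < 2 ^ (s + 1) := by positivity
    rw [pow_succ]
    nlinarith
  have hs0 : (0 : ℝ) ≤ s := Nat.cast_nonneg s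
  have he : 0 ≤ ((s : ℝ) + 1 / 2) * ρ * m := by positivity
  have hX : ((2 : ℝ) ^ ((s + 1) ^ 2)) ^ (2 * q * (K - 1)) ≤
      (2 ^ (s + 1) * ρ * m * (4 * s + 2)) ^ (((s : ℝ) + 1 / 2) * ρ * m) := by
    refine le_trans ?_ (Real.rpow_le_rpow (by positivity) hbase he)
    rw [← pow_mul, ← Real.rpow_natCast, ← Real.rpow_natCast, ← Real.rpow_mul (by norm_num)]
    apply Real.rpow_le_rpow_of_exponent_le (by norm_num)
    push_cast
    rw [hcast]
    have b1 : (2 : ℝ) * q ≤ ρ := by rw [hρ]; push_cast; linarith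
    have b2 : ((s : ℝ) + 1) ^ 2 ≤ (s + 2) * (s + 1 / 2) := by nlinarith
    have b3 : 2 * (q : ℝ) * m ≤ ρ * m := by nlinarith
    calc ((s : ℝ) + 1) ^ 2 * (2 * q * m) ≤ ((s + 2) * (s + 1 / 2)) * (ρ * m) :=
          mul_le_mul b2 b3 (by positivity) (by positivity)
      _ = _ := by ring
  rw [Real.rpow_neg (by positivity), mul_pow, ← pow_mul]
  have hYp : 0 < ((2 : ℝ) ^ ((s + 1) ^ 2)) ^ (2 * q * (K - 1)) := by positivity
  have hXp := lt_of_lt_of_le hYp hX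
  set X := (2 ^ (s + 1) * ρ * m * (4 * s + 2)) ^ (((s : ℝ) + 1 / 2) * ρ * m)
  set Y := ((2 : ℝ) ^ ((s + 1) ^ 2)) ^ (2 * q * (K - 1))
  have h4 : 0 < 4 * m - 1 := by linarith
  have e : X⁻¹ / (4 * Real.sqrt K * (4 * m - 1) * 2 ^ (K - 1)) *
      (Real.sqrt K * (2 * m * (2 ^ (K - 1) * Y))) = (m * Y) / (2 * (4 * m - 1) * X) := by
    field_simp
    ring
  rw [e, div_le_one (by positivity)]
  nlinarith [mul_pos (by linarith : 0 < m) hYp]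

/-- Margin transformation: if examples in the unit ball of `ℝ^d` are weakly linearly
separable with margin `γ > 0`, then their images under the feature map `φ` are strongly
linearly separable in `ℓ²` with margin `γ' = max{γ₁, γ₂}`, and `‖φ(x_t)‖² ≤ 2` for all `t`. -/
theorem margin_transformation
    {d K T : ℕ} (hK : 2 ≤ K) (γ : ℝ) (hγ : 0 < γ)
    (x : Fin T → EuclideanSpace ℝ (Fin d)) (y : Fin T → Fin K)
    (hx : ∀ t, ‖x t‖ ≤ 1)
    (hweak : WeaklySeparable x y γ)
    (r s : ℕ)
    (hr : r = 2 * ⌈(1 / 4 : ℝ) * Real.logb 2 (4 * K - 3)⌉₊ + 1)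
    (hs : s = ⌈Real.logb 2 (2 / γ)⌉₊)
    (γ₁ γ₂ : ℝ)
    (hγ₁ : γ₁ = (376 * ((⌈Real.logb 2 (2 * K - 2)⌉₊ * ⌈Real.sqrt (2 / γ)⌉₊ : ℕ) : ℝ)) ^
        (-(((⌈Real.logb 2 (2 * K - 2)⌉₊ * ⌈Real.sqrt (2 / γ)⌉₊ : ℕ) : ℝ) / 2)) /
        (2 * Real.sqrt K))
    (hγ₂ : γ₂ = ((2 : ℝ) ^ (s + 1) * r * ((K : ℝ) - 1) * (4 * s + 2)) ^
        (-(((s : ℝ) + 1 / 2) * r * ((K : ℝ) - 1))) /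
        (4 * Real.sqrt K * (4 * (K : ℝ) - 5) * 2 ^ (K - 1))) :
    ∃ Φ : Fin T → lp (fun _ : Fin d →₀ ℕ => ℝ) 2,
      (∀ t, ∃ hm : Memℓp (phiMap d (x t)) 2, Φ t = ⟨phiMap d (x t), hm⟩) ∧
      StronglySeparable Φ y (max γ₁ γ₂) ∧
      ∀ t, ‖Φ t‖ ^ 2 ≤ 2 := by
  have hmem := fun t => phi_mem (x t) (hx t)
  have hΦ : ∀ t, ((⟨phiMap d (x t), hmem t⟩ : HH d) : (Fin d →₀ ℕ) → ℝ) = phiMap d (x t) :=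
    fun t => rfl
  have hK1 : (2 : ℝ) ≤ K := by exact_mod_cast hK
  refine ⟨fun t => ⟨phiMap d (x t), hmem t⟩, fun t => ⟨hmem t, rfl⟩, ?_, fun t => ?_⟩
  · rcases max_choice γ₁ γ₂ with h | h
    · rw [h]
      have hL1 : 1 ≤ ⌈Real.logb 2 (2 * (K : ℝ) - 2)⌉₊ := by
        rw [Nat.one_le_ceil_iff]
        exact Real.logb_pos (by norm_num) (by linarith)
      have hM1 : 1 ≤ ⌈Real.sqrt (2 / γ)⌉₊ := by
        rw [Nat.one_le_ceil_iff]
        exact Real.sqrt_pos.2 (by positivity)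
      have hL : 2 * ((K : ℝ) - 1) ≤ 2 ^ ⌈Real.logb 2 (2 * (K : ℝ) - 2)⌉₊ := by
        have := (Real.logb_le_iff_le_rpow (by norm_num) (by linarith)).1
          (Nat.le_ceil (Real.logb 2 (2 * (K : ℝ) - 2)))
        rw [Real.rpow_natCast] at this
        linarith
      have hM : 2 / γ ≤ (⌈Real.sqrt (2 / γ)⌉₊ : ℝ) ^ 2 :=
        (Real.sqrt_le_left (by positivity)).1 (Nat.le_ceil _)
      refine strong_one hK γ hγ x y hx hweak hΦ _ _ hL hM ?_
      rw [hγ₁]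
      exact num_one K _ _ hK hL1 hM1 hL
    · rw [h]
      have hs' : 2 / γ ≤ 2 ^ s := by
        have := (Real.logb_le_iff_le_rpow (by norm_num) (by positivity)).1
          (Nat.le_ceil (Real.logb 2 (2 / γ)))
        rw [← hs, Real.rpow_natCast] at this
        exact this
      generalize hq : ⌈(1 / 4 : ℝ) * Real.logb 2 (4 * K - 3)⌉₊ = q at hr
      have hq' : 4 * ((K : ℝ) - 1) + 1 ≤ 4 ^ (2 * q) := by
        have h1 := Nat.le_ceil ((1 / 4 : ℝ) * Real.logb 2 (4 * K - 3))
        rw [hq] at h1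
        have h2 : Real.logb 2 (4 * K - 3) ≤ ((4 * q : ℕ) : ℝ) := by push_cast; linarith
        have := (Real.logb_le_iff_le_rpow (by norm_num) (by linarith)).1 h2
        rw [Real.rpow_natCast] at this
        have e : (4 : ℝ) ^ (2 * q) = 2 ^ (4 * q) := by
          rw [pow_mul, pow_mul]; norm_num
        rw [e]
        linarith
      refine strong_two hK γ hγ x y hx hweak hΦ s q hs' hq' ?_
      rw [hγ₂, hr]
      exact num_two K s q hK
  · rw [norm_sq_eq]
    exact Real.tsum_le_of_sum_le (fun _ => sq_nonneg _) (phi_sum_le (x t) (hx t))
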